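/- Fix a ∈ (0, π) and let b, c : ℝ → (0, π) be differentiable at t₀ and such that for every t in a neighborhood of t₀ the triple (a, b(t), c(t)) forms a valid spherical triangle. Define the angles α(t) = ang(a; b(t), c(t)), β(t) = ang(b(t); c(t), a), γ(t) = ang(c(t); a, b(t)). Then α′(t₀) + β′(t₀)·cos(c(t₀)) + γ′(t₀)·cos(b(t₀)) = 0. -/

import Mathlib

/-- `sAng z x y` is the angle opposite the side of length `z` in a spherical triangle
with side lengths `x`, `y`, `z` (spherical law of cosines). -/
noncomputable def sAng (z x y : ℝ) : ℝ :=
  Real.arccos ((Real.cos z - Real.cos x * Real.cos y) / (Real.sin x * Real.sin y))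

/-- `x`, `y`, `z` are the side lengths of a valid (nondegenerate) spherical triangle. -/
def ValidTriangle (x y z : ℝ) : Prop :=
  0 < x ∧ x < Real.pi ∧ 0 < y ∧ y < Real.pi ∧ 0 < z ∧ z < Real.pi ∧
    |x - y| < z ∧ z < x + y ∧ x + y + z < 2 * Real.pi

/-- The Gram determinant of a nondegenerate spherical triangle is positive. -/
theorem ValidTriangle.gram_pos {x y z : ℝ} (h : ValidTriangle x y z) :
    0 < 1 - Real.cos x ^ 2 - Real.cos y ^ 2 - Real.cos z ^ 2
      + 2 * Real.cos x * Real.cos y * Real.cos z := by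
  obtain ⟨hx, hx', hy, hy', hz, hz', h₁, h₂, h₃⟩ := h
  have hsum : 0 < Real.cos z - Real.cos (x + y) := by
    have hs₁ : 0 < Real.sin ((z + (x + y)) / 2) :=
      Real.sin_pos_of_pos_of_lt_pi (by linarith) (by linarith)
    have hs₂ : Real.sin ((z - (x + y)) / 2) < 0 :=
      Real.sin_neg_of_neg_of_neg_pi_lt (by linarith) (by linarith)
    rw [Real.cos_sub_cos]
    nlinarith [mul_pos_of_neg_of_neg (neg_neg_of_pos hs₁) hs₂]
  have hdiff : 0 < Real.cos (x - y) - Real.cos z := by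
    rw [← Real.cos_abs (x - y), sub_pos]
    exact Real.cos_lt_cos_of_nonneg_of_le_pi (abs_nonneg _) hz'.le h₁
  have hprod := mul_pos hsum hdiff
  rw [Real.cos_add, Real.cos_sub] at hprod
  have key : Real.sin x ^ 2 * Real.sin y ^ 2 = (1 - Real.cos x ^ 2) * (1 - Real.cos y ^ 2) := by
    rw [Real.sin_sq, Real.sin_sq]
  nlinarith

/-- The derivative of an angle of a spherical triangle in terms of those of the sides; `D` is
the square root of the Gram determinant. -/
theorem hasDerivAt_sAng {x y z : ℝ → ℝ} {x' y' z' t D : ℝ}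
    (hx : HasDerivAt x x' t) (hy : HasDerivAt y y' t) (hz : HasDerivAt z z' t)
    (hsx : 0 < Real.sin (x t)) (hsy : 0 < Real.sin (y t)) (hD : 0 < D)
    (hD2 : D ^ 2 = 1 - Real.cos (x t) ^ 2 - Real.cos (y t) ^ 2 - Real.cos (z t) ^ 2
      + 2 * Real.cos (x t) * Real.cos (y t) * Real.cos (z t)) :
    HasDerivAt (fun s => sAng (z s) (x s) (y s))
      ((Real.sin (z t) * z'
        - (Real.cos (y t) - Real.cos (x t) * Real.cos (z t)) / Real.sin (x t) * x'
        - (Real.cos (x t) - Real.cos (y t) * Real.cos (z t)) / Real.sin (y t) * y') / D) t := by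
  have hx2 := Real.sin_sq (x t)
  have hy2 := Real.sin_sq (y t)
  have hu : 1 - ((Real.cos (z t) - Real.cos (x t) * Real.cos (y t)) /
      (Real.sin (x t) * Real.sin (y t))) ^ 2 = (D / (Real.sin (x t) * Real.sin (y t))) ^ 2 := by
    rw [div_pow, div_pow, hD2, mul_pow, eq_div_iff (by positivity), sub_mul,
      div_mul_cancel₀ _ (by positivity), hx2, hy2]
    ring
  have hpos : 0 < (D / (Real.sin (x t) * Real.sin (y t))) ^ 2 := by positivity
  have hquot := (hz.cos.fun_sub (hx.cos.fun_mul hy.cos)).fun_div (hx.sin.fun_mul hy.sin)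
    (mul_pos hsx hsy).ne'
  have harc := (Real.hasDerivAt_arccos (fun h => by rw [← hu, h] at hpos; norm_num at hpos)
    (fun h => by rw [← hu, h] at hpos; norm_num at hpos)).comp t hquot
  rw [hu, Real.sqrt_sq (by positivity)] at harc
  refine harc.congr_deriv ?_
  field_simp
  linear_combination
    -Real.sin (y t) * x' * Real.cos (y t) * hx2 - Real.sin (x t) * Real.cos (x t) * y' * hy2

/-- In a spherical triangle with one side length `a` fixed, the variations of the three
angles satisfy `α′ + β′·cos c + γ′·cos b = 0`. -/
theorem spherical_triangle_angle_variation (a : ℝ) (ha : 0 < a ∧ a < Real.pi)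
    (b c : ℝ → ℝ) (t₀ b' c' : ℝ)
    (hb : HasDerivAt b b' t₀) (hc : HasDerivAt c c' t₀)
    (hvalid : ∀ᶠ t in nhds t₀, ValidTriangle a (b t) (c t)) :
    ∃ α' β' γ' : ℝ,
      HasDerivAt (fun t => sAng a (b t) (c t)) α' t₀ ∧
      HasDerivAt (fun t => sAng (b t) (c t) a) β' t₀ ∧
      HasDerivAt (fun t => sAng (c t) a (b t)) γ' t₀ ∧
      α' + β' * Real.cos (c t₀) + γ' * Real.cos (b t₀) = 0 := by
  have hv := hvalid.self_of_nhds
  have hgram := hv.gram_pos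
  obtain ⟨_, _, hb₀, hbπ, hc₀, hcπ, -⟩ := hv
  have hsa := Real.sin_pos_of_pos_of_lt_pi ha.1 ha.2
  have hsb := Real.sin_pos_of_pos_of_lt_pi hb₀ hbπ
  have hsc := Real.sin_pos_of_pos_of_lt_pi hc₀ hcπ
  obtain ⟨D, hD, hD2⟩ : ∃ D > 0, D ^ 2 = _ := ⟨_, Real.sqrt_pos.2 hgram, Real.sq_sqrt hgram.le⟩
  have hconst := hasDerivAt_const t₀ a
  refine ⟨_, _, _, hasDerivAt_sAng hb hc hconst hsb hsc hD (by rw [hD2]; ring),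
    hasDerivAt_sAng hc hconst hb hsc hsa hD (by rw [hD2]; ring),
    hasDerivAt_sAng hconst hb hc hsa hsb hD hD2, ?_⟩
  have hb2 := Real.sin_sq (b t₀)
  have hc2 := Real.sin_sq (c t₀)
  field_simp
  linear_combination
    Real.sin a * Real.cos (c t₀) * Real.sin (c t₀) * b' * hb2
      + Real.sin a * Real.sin (b t₀) * Real.cos (b t₀) * c' * hc2
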